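/- arXiv:0903.2520 — 4 statements merged into one kernel-verified Lean document; each statement's English description precedes it below -/
import Mathlib

section
/- There exists a constant Q_0 such that the following holds for every odd prime power q ≥ Q_0. Let Z ⊆ F_q^2 be a set such that for all pairwise distinct u, v, w ∈ Z the element Δ(u,v,w) is a nonzero square in F_q (i.e. every triple of distinct points of Z determines an acute angle triangle). Then #Z ≤ 2·q^{4/3}. -/
open Finset

/-- `Δ(u,v,w) = Σ_i ((u_i−v_i)² + (u_i−w_i)² − (v_i−w_i)²)`. -/
def delta {F : Type*} [Field F] {n : ℕ} (u v w : Fin n → F) : F :=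
  ∑ i, ((u i - v i) ^ 2 + (u i - w i) ^ 2 - (v i - w i) ^ 2)

/-- If all the products `κ * (a - b) * (a - c)`, for `a`, `b`, `c` distinct in `S`, are nonzero
squares, then `S` has at most `√q` elements, unless it has at most three. -/
theorem sq_card_le_of_quadraticChar_eq_one {F : Type*} [Field F] [Fintype F] [DecidableEq F]
    (hF : ringChar F ≠ 2) (S : Finset F) (κ : F)
    (hS : ∀ a ∈ S, ∀ b ∈ S, ∀ c ∈ S, a ≠ b → a ≠ c → b ≠ c →
      quadraticChar F (κ * ((a - b) * (a - c))) = 1)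
    (h3 : 3 < S.card) : S.card ^ 2 ≤ Fintype.card F := by
  have hpm : ∀ a ∈ S, ∀ b ∈ S, a ≠ b →
      quadraticChar F (a - b) = 1 ∨ quadraticChar F (a - b) = -1 := fun a _ b _ h =>
    quadraticChar_dichotomy (sub_ne_zero.2 h)
  have hneg : ∀ a b : F, quadraticChar F (b - a) =
      quadraticChar F (-1) * quadraticChar F (a - b) := fun a b => by
    rw [← map_mul]; congr 1; ring
  have hn1 : quadraticChar F (-1 : F) = 1 ∨ quadraticChar F (-1 : F) = -1 :=
    quadraticChar_dichotomy (neg_ne_zero.2 one_ne_zero)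
  have hκ : quadraticChar F κ = 1 := by
    obtain ⟨T, hTS, hT⟩ := Finset.exists_subset_card_eq (show 4 ≤ S.card from h3)
    obtain ⟨a, b, c, e, hab, hac, hae, hbc, hbe, hce, rfl⟩ := Finset.card_eq_four.1 hT
    have ha : a ∈ S := hTS (by simp)
    have hb : b ∈ S := hTS (by simp)
    have hc : c ∈ S := hTS (by simp)
    have he : e ∈ S := hTS (by simp)
    have h1 := hS a ha b hb c hc hab hac hbc
    have h2 := hS a ha b hb e he hab hae hbe
    have h3 := hS a ha c hc e he hac hae hce
    simp only [map_mul] at h1 h2 h3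
    rcases hpm a ha b hb hab with p | p <;> rcases hpm a ha c hc hac with r | r <;>
      rcases hpm a ha e he hae with s | s <;> simp only [p, r, s] at h1 h2 h3 <;> lia
  have hstar : ∀ a ∈ S, ∀ b ∈ S, ∀ c ∈ S, a ≠ b → a ≠ c →
      quadraticChar F (a - b) = quadraticChar F (a - c) := by
    intro a ha b hb c hc hab hac
    by_cases hbc : b = c
    · rw [hbc]
    have h1 := hS a ha b hb c hc hab hac hbc
    simp only [map_mul, hκ] at h1
    rcases hpm a ha b hb hab with p | p <;> rcases hpm a ha c hc hac with r | r <;>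
      simp only [p, r] at h1 ⊢ <;> lia
  have hm1 : quadraticChar F (-1 : F) = 1 := by
    obtain ⟨T, hTS, hT⟩ := Finset.exists_subset_card_eq h3.le
    obtain ⟨a, b, c, hab, hac, hbc, rfl⟩ := Finset.card_eq_three.1 hT
    have ha : a ∈ S := hTS (by simp)
    have hb : b ∈ S := hTS (by simp)
    have hc : c ∈ S := hTS (by simp)
    have h1 := hstar a ha b hb c hc hab hac
    have h2 := hstar b hb a ha c hc hab.symm hbc
    have h3 := hstar c hc a ha b hb hac.symm hbc.symm
    rw [hneg a b] at h2
    rw [hneg a c, hneg b c] at h3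
    rcases hpm a ha b hb hab with p | p <;> rcases hpm a ha c hc hac with r | r <;>
      rcases hpm b hb c hc hbc with s | s <;> rcases hn1 with t | t <;>
      simp only [p, r, s, t] at h1 h2 h3 ⊢ <;> lia
  have hconst : ∀ a ∈ S, ∀ b ∈ S, ∀ c ∈ S, ∀ d ∈ S, a ≠ b → c ≠ d →
      quadraticChar F (a - b) = quadraticChar F (c - d) := by
    intro a ha b hb c hc d hd hab hcd
    by_cases hac : a = c
    · subst hac; exact hstar a ha b hb d hd hab hcd
    rw [hstar a ha b hb c hc hab hac, hneg c a, hm1, one_mul]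
    exact hstar c hc a ha d hd (Ne.symm hac) hcd
  obtain ⟨g, hg⟩ := FiniteField.exists_nonsquare hF
  have hg' : quadraticChar F g = -1 := quadraticChar_neg_one_iff_not_isSquare.2 hg
  rw [sq, ← Finset.card_product, ← Finset.card_univ]
  refine Finset.card_le_card_of_injOn (fun p => p.1 + g * p.2) (fun _ _ => Finset.mem_univ _) ?_
  rintro ⟨a, b⟩ hab ⟨c, d⟩ hcd h
  simp only [Finset.coe_product, Set.mem_prod, Finset.mem_coe] at hab hcd h
  have h' : a - c = g * (d - b) := by linear_combination h
  by_cases hac : a = c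
  · have hg0 : g ≠ 0 := fun h0 => hg (h0 ▸ IsSquare.zero)
    rw [hac, sub_self, eq_comm, mul_eq_zero, sub_eq_zero] at h'
    rw [hac, h'.resolve_left hg0]
  · have hdb : d ≠ b := fun h0 => hac (by rw [h0, sub_self, mul_zero, sub_eq_zero] at h'; exact h')
    have h1 := hconst a hab.1 c hcd.1 d hcd.2 b hab.2 hac hdb
    rw [h', map_mul, hg'] at h1
    rcases hpm d hcd.2 b hab.2 hdb with p | p <;> rw [p] at h1 <;> lia

/-- Quadratic characters of two linearly independent linear forms on `F²` are orthogonal. -/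
theorem sum_quadraticChar_mul_eq_zero {F : Type*} [Field F] [Fintype F] [DecidableEq F]
    (hF : ringChar F ≠ 2) (a b : Fin 2 → F) (hab : a 0 * b 1 ≠ a 1 * b 0) :
    ∑ c : Fin 2 → F, quadraticChar F (a 0 * c 0 + a 1 * c 1) *
      quadraticChar F (b 0 * c 0 + b 1 * c 1) = 0 := by
  have hbij : Function.Bijective
      (fun c : Fin 2 → F => (a 0 * c 0 + a 1 * c 1, b 0 * c 0 + b 1 * c 1)) := by
    rw [Fintype.bijective_iff_injective_and_card]
    refine ⟨fun c d h => ?_, by simp [sq]⟩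
    obtain ⟨h1, h2⟩ := Prod.mk.inj h
    have h0 := sub_ne_zero.2 hab
    ext i
    fin_cases i
    · refine mul_left_cancel₀ h0 ?_
      dsimp only [Fin.zero_eta, Fin.mk_one]
      linear_combination b 1 * h1 - a 1 * h2
    · refine mul_left_cancel₀ h0 ?_
      dsimp only [Fin.zero_eta, Fin.mk_one]
      linear_combination a 0 * h2 - b 0 * h1
  rw [hbij.sum_comp (fun p : F × F => quadraticChar F p.1 * quadraticChar F p.2),
    Fintype.sum_prod_type]
  simp only [← Finset.mul_sum, quadraticChar_sum_zero hF, mul_zero, Finset.sum_const_zero]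

/-- A set of vectors in `F²` with pairwise inner products in one quadratic class, and at most `m`
vectors on each line through the origin, has at most about `q * √m` elements. -/
theorem sq_card_sub_two_le {F : Type*} [Field F] [Fintype F] [DecidableEq F]
    (hF : ringChar F ≠ 2) (A : Finset (Fin 2 → F)) (m : ℕ) (hA2 : 2 ≤ A.card)
    (hA : ∀ a ∈ A, ∀ b ∈ A, a ≠ b →
      quadraticChar F 2 * quadraticChar F (a 0 * b 0 + a 1 * b 1) = 1)
    (hm : ∀ a ∈ A, {b ∈ A | a 0 * b 1 = a 1 * b 0}.card ≤ m) :
    ((A.card : ℤ) - 2) ^ 2 ≤ m * (Fintype.card F : ℤ) ^ 2 := by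
  set χ := quadraticChar F
  have hχ : ∀ x : F, χ x = 0 ∨ χ x = 1 ∨ χ x = -1 := fun x => by
    by_cases hx : x = 0
    · left; simp [hx, χ]
    · right; exact quadraticChar_dichotomy hx
  have h2 : χ 2 ^ 2 = 1 := quadraticChar_sq_one (Ring.two_ne_zero hF)
  let f : (Fin 2 → F) → ℤ := fun c => ∑ a ∈ A, χ (a 0 * c 0 + a 1 * c 1)
  have hlow : ∀ c ∈ A, ((A.card : ℤ) - 2) ^ 2 ≤ f c ^ 2 := by
    intro c hc
    have h1 : χ 2 * f c ≥ (A.card : ℤ) - 2 := by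
      have hsum : ∑ a ∈ A.erase c, χ 2 * χ (a 0 * c 0 + a 1 * c 1) = (A.card : ℤ) - 1 := by
        rw [Finset.sum_congr rfl fun a ha =>
          hA a (Finset.mem_of_mem_erase ha) c hc (Finset.ne_of_mem_erase ha)]
        have := Finset.card_erase_add_one hc
        simp only [Finset.sum_const, nsmul_eq_mul, mul_one]
        lia
      have hcc : -1 ≤ χ 2 * χ (c 0 * c 0 + c 1 * c 1) := by
        rcases hχ 2 with p | p | p <;> rcases hχ (c 0 * c 0 + c 1 * c 1) with r | r | r <;>
          rw [p, r] <;> norm_num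
      simp only [f, Finset.mul_sum]
      rw [← Finset.sum_erase_add _ _ hc, hsum]
      linarith
    have h3 : f c ^ 2 = (χ 2 * f c) ^ 2 := by rw [mul_pow, h2, one_mul]
    rw [h3]
    have : (2 : ℤ) ≤ A.card := by exact_mod_cast hA2
    exact pow_le_pow_left₀ (by linarith) h1 2
  have hup : ∑ c, f c ^ 2 ≤ A.card * (m * (Fintype.card F : ℤ) ^ 2) := by
    have hexp : ∑ c, f c ^ 2 = ∑ a ∈ A, ∑ b ∈ A, ∑ c : Fin 2 → F,
        χ (a 0 * c 0 + a 1 * c 1) * χ (b 0 * c 0 + b 1 * c 1) := by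
      simp only [f, sq, Finset.sum_mul_sum]
      rw [Finset.sum_comm]
      exact Finset.sum_congr rfl fun a _ => Finset.sum_comm
    rw [hexp, ← nsmul_eq_mul]
    refine Finset.sum_le_card_nsmul _ _ _ fun a ha => ?_
    calc _ ≤ ∑ b ∈ A, if a 0 * b 1 = a 1 * b 0 then (Fintype.card F : ℤ) ^ 2 else 0 := by
          refine Finset.sum_le_sum fun b _ => ?_
          split_ifs with h
          · calc _ ≤ ∑ c : Fin 2 → F, (1 : ℤ) := by
                  refine Finset.sum_le_sum fun c _ => ?_
                  rcases hχ (a 0 * c 0 + a 1 * c 1) with p | p | p <;>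
                    rcases hχ (b 0 * c 0 + b 1 * c 1) with r | r | r <;> rw [p, r] <;> norm_num
              _ = _ := by simp
          · exact (sum_quadraticChar_mul_eq_zero hF a b h).le
      _ = ({b ∈ A | a 0 * b 1 = a 1 * b 0}.card : ℤ) * (Fintype.card F : ℤ) ^ 2 := by
          rw [← Finset.sum_filter, Finset.sum_const, nsmul_eq_mul]
      _ ≤ _ := by
          have := hm a ha
          gcongr
  have hmid : A.card * ((A.card : ℤ) - 2) ^ 2 ≤ ∑ c, f c ^ 2 := by
    rw [← nsmul_eq_mul]
    exact (Finset.card_nsmul_le_sum _ _ _ hlow).trans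
      (Finset.sum_le_sum_of_subset_of_nonneg (Finset.subset_univ A) fun c _ _ => sq_nonneg _)
  exact le_of_mul_le_mul_left (hmid.trans hup) (by exact_mod_cast (by lia : 0 < A.card))

/-- In a set of points of `F²` which has only acute angle triangles, at most `√q` points lie on any
given line through the origin. -/
theorem sq_card_collinear_le {F : Type*} [Field F] [Fintype F] [DecidableEq F]
    (hF : ringChar F ≠ 2) (hq : 9 ≤ Fintype.card F) (B : Finset (Fin 2 → F))
    (hB : ∀ u ∈ B, ∀ v ∈ B, ∀ w ∈ B, u ≠ v → u ≠ w → v ≠ w →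
      quadraticChar F (delta u v w) = 1)
    (a : Fin 2 → F) (ha0 : a ≠ 0) :
    {b ∈ B | a 0 * b 1 = a 1 * b 0}.card ^ 2 ≤ Fintype.card F := by
  let S : Finset F := {t | t • a ∈ B}
  have hinj : Function.Injective (fun t : F => t • a) := smul_left_injective F ha0
  have hcard : {b ∈ B | a 0 * b 1 = a 1 * b 0}.card = S.card := by
    rw [← Finset.card_image_of_injective S hinj]
    congr 1
    ext b
    simp only [S, Finset.mem_filter, Finset.mem_image, Finset.mem_univ, true_and]
    constructor
    · rintro ⟨hb, h⟩
      have hex : ∃ t : F, t • a = b := by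
        by_cases h00 : a 0 = 0
        · have h1 : a 1 ≠ 0 := fun h1 => ha0 (by ext i; fin_cases i <;> assumption)
          refine ⟨b 1 / a 1, ?_⟩
          ext i
          fin_cases i
          · simp only [h00, zero_mul, Fin.zero_eta, Pi.smul_apply, smul_eq_mul, mul_zero] at h ⊢
            exact ((mul_eq_zero.1 h.symm).resolve_left h1).symm
          · simp [h1]
        · refine ⟨b 0 / a 0, ?_⟩
          ext i
          fin_cases i
          · simp [h00]
          · simp only [Fin.mk_one, Pi.smul_apply, smul_eq_mul]
            field_simp
            linear_combination -h
      obtain ⟨t, rfl⟩ := hex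
      exact ⟨t, hb, rfl⟩
    · rintro ⟨t, ht, rfl⟩
      exact ⟨ht, by simp only [Pi.smul_apply, smul_eq_mul]; ring⟩
  rw [hcard]
  by_cases h3 : 3 < S.card
  · refine sq_card_le_of_quadraticChar_eq_one hF S (2 * (a 0 ^ 2 + a 1 ^ 2)) ?_ h3
    intro r hr s hs t ht hrs hrt hst
    simp only [S, Finset.mem_filter, Finset.mem_univ, true_and] at hr hs ht
    have h := hB _ hr _ hs _ ht (hinj.ne hrs) (hinj.ne hrt) (hinj.ne hst)
    rw [← h]
    congr 1
    simp only [delta, Fin.sum_univ_two, Pi.smul_apply, smul_eq_mul]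
    ring
  · have : S.card ≤ 3 := not_lt.1 h3
    nlinarith

/-- There is a constant `Q₀` such that for every finite field `F` of odd
cardinality `q ≥ Q₀` and every `Z ⊆ F²` all of whose triples of pairwise
distinct points have `Δ` a nonzero square, one has `#Z ≤ 2·q^{4/3}`. -/
theorem card_le_of_acute :
    ∃ Q0 : ℕ, ∀ (F : Type) [Field F] [Fintype F],
      Odd (Fintype.card F) → Q0 ≤ Fintype.card F →
      ∀ Z : Finset (Fin 2 → F),
        (∀ u ∈ Z, ∀ v ∈ Z, ∀ w ∈ Z, u ≠ v → u ≠ w → v ≠ w →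
          ∃ β : F, β ≠ 0 ∧ delta u v w = β ^ 2) →
        (Z.card : ℝ) ≤ 2 * (Fintype.card F : ℝ) ^ ((4 : ℝ) / 3) := by
  refine ⟨9, fun F _ _ hodd hq Z hZ => ?_⟩
  classical
  have hF : ringChar F ≠ 2 := fun h => by
    have := FiniteField.even_card_of_char_two h
    rw [Nat.odd_iff] at hodd
    lia
  set q := Fintype.card F
  have hq1 : (9 : ℝ) ≤ q := by exact_mod_cast hq
  have hqq : (q : ℝ) ≤ (q : ℝ) ^ ((4 : ℝ) / 3) :=
    Real.self_le_rpow_of_one_le (by linarith) (by norm_num)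
  by_cases hz : Z.card ≤ 3
  · have : (Z.card : ℝ) ≤ 3 := by exact_mod_cast hz
    linarith
  obtain ⟨u, hu⟩ : Z.Nonempty := Finset.card_pos.1 (by lia)
  let B : Finset (Fin 2 → F) := Z.image (fun v => v - u)
  have hBcard : B.card = Z.card := Finset.card_image_of_injective _ (sub_left_injective)
  have h0 : (0 : Fin 2 → F) ∈ B := Finset.mem_image.2 ⟨u, hu, sub_self u⟩
  have hB : ∀ u ∈ B, ∀ v ∈ B, ∀ w ∈ B, u ≠ v → u ≠ w → v ≠ w →
      quadraticChar F (delta u v w) = 1 := by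
    simp only [B, Finset.forall_mem_image]
    intro x hx y hy z hz hxy hxz hyz
    obtain ⟨β, hβ, h⟩ := hZ x hx y hy z hz (fun h => hxy (by rw [h]))
      (fun h => hxz (by rw [h])) (fun h => hyz (by rw [h]))
    have h' : delta (x - u) (y - u) (z - u) = β ^ 2 := by
      rw [← h]
      simp only [delta, Pi.sub_apply, sub_sub_sub_cancel_right]
    rw [h', quadraticChar_sq_one' hβ]
  have hcardA : (B.erase 0).card + 1 = Z.card := by rw [Finset.card_erase_add_one h0, hBcard]
  have key := sq_card_sub_two_le hF (B.erase 0) (Nat.sqrt q) (by lia) (by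
      intro a ha b hb hab
      rw [Finset.mem_erase] at ha hb
      rw [← map_mul, ← hB 0 h0 a ha.2 b hb.2 ha.1.symm hb.1.symm hab]
      congr 1
      simp only [delta, Fin.sum_univ_two, Pi.zero_apply]
      ring) (by
      intro a ha
      rw [Finset.mem_erase] at ha
      refine (Finset.card_le_card (Finset.filter_subset_filter _ (Finset.erase_subset 0 B))).trans ?_
      rw [Nat.le_sqrt']
      exact sq_card_collinear_le hF hq B hB a ha.1)
  set n : ℤ := ((B.erase 0).card : ℤ) - 2 with hn
  have hn0 : 0 ≤ n := by lia
  have hn4 : n ^ 4 ≤ (q : ℤ) ^ 5 := by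
    have hs : ((Nat.sqrt q : ℕ) : ℤ) ^ 2 ≤ q := by exact_mod_cast Nat.sqrt_le' q
    calc n ^ 4 = (n ^ 2) ^ 2 := by ring
      _ ≤ ((Nat.sqrt q : ℕ) * (q : ℤ) ^ 2) ^ 2 := pow_le_pow_left₀ (sq_nonneg n) key 2
      _ = ((Nat.sqrt q : ℕ) : ℤ) ^ 2 * (q : ℤ) ^ 4 := by ring
      _ ≤ q * (q : ℤ) ^ 4 := by gcongr
      _ = (q : ℤ) ^ 5 := by ring
  have hnR : (n : ℝ) ≤ (q : ℝ) ^ ((4 : ℝ) / 3) := by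
    have h4 : (n : ℝ) ^ 4 ≤ (q : ℝ) ^ 5 := by exact_mod_cast hn4
    refine le_of_pow_le_pow_left₀ (n := 4) (by norm_num) (by positivity) (h4.trans ?_)
    rw [← Real.rpow_mul_natCast (by positivity), ← Real.rpow_natCast]
    exact Real.rpow_le_rpow_of_exponent_le (by linarith) (by norm_num)
  have hZn : (Z.card : ℝ) = n + 3 := by
    have : (Z.card : ℤ) = n + 3 := by rw [hn, ← hcardA]; push_cast; ring
    exact_mod_cast this
  linarith
end

section
/- Let q be an odd prime power, n ≥ 1, and ψ: F_q → ℂ a nontrivial additive character of F_q. For a finite set Z ⊆ F_q^n define S_ψ(Z) = Σ_{u,v,w ∈ Z} ψ(Δ(u,v,w)). Then |S_ψ(Z)|^2 ≤ #Z · q^n · Re( Σ ψ(2(v·w − x·y)) ), where the sum on the right is over all quadruples (v,w,x,y) ∈ Z^4 with v + w = x + y, and a·b denotes the standard inner product on F_q^n. (The sum on the right is in fact a real number, since it is invariant under swapping (v,w) with (x,y), which conjugates each summand.) -/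
open Finset

/-- Standard inner product on `F^n`. -/
def dotp {F : Type*} [Field F] {n : ℕ} (a b : Fin n → F) : F :=
  ∑ i, a i * b i

theorem two_ne_zero_of_odd_card {F : Type*} [Field F] [Fintype F]
    (hq : Odd (Fintype.card F)) : (2 : F) ≠ 0 := by
  refine Ring.two_ne_zero fun h => ?_
  have h2 := FiniteField.even_card_of_char_two h
  rw [Nat.odd_iff] at hq
  omega

theorem delta_eq {F : Type*} [Field F] {n : ℕ} (u v w : Fin n → F) :
    delta u v w = 2 * dotp u u + (2 * dotp v w + dotp u (fun i => -2 * (v + w) i)) := by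
  simp only [delta, dotp, Finset.mul_sum, ← Finset.sum_add_distrib, Pi.add_apply]
  exact Finset.sum_congr rfl fun i _ => by ring

theorem dotp_sub {F : Type*} [Field F] {n : ℕ} (u a b : Fin n → F) :
    dotp u (a - b) = dotp u a - dotp u b := by
  simp only [dotp, Pi.sub_apply, mul_sub, Finset.sum_sub_distrib]

/-- Orthogonality of the characters of `F^n`. -/
theorem sum_addChar_dotp {F : Type*} [Field F] [Fintype F] [DecidableEq F] {n : ℕ}
    {ψ : AddChar F ℂ} (hψ : ψ ≠ 1) (b : Fin n → F) :
    ∑ u : Fin n → F, ψ (dotp u b) = if b = 0 then (Fintype.card F : ℂ) ^ n else 0 := by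
  have hprod : ∑ u : Fin n → F, ψ (dotp u b) = ∏ i, ∑ t : F, ψ (t * b i) := by
    rw [Finset.prod_univ_sum, Fintype.piFinset_univ]
    refine Finset.sum_congr rfl fun u _ => ?_
    exact map_prod ψ.toMonoidHom (fun i => Multiplicative.ofAdd (u i * b i)) Finset.univ
  rw [hprod]
  simp only [AddChar.sum_mulShift _ (AddChar.IsPrimitive.of_ne_one hψ)]
  split_ifs with hb
  · simp [hb]
  · obtain ⟨i, hi⟩ := Function.ne_iff.mp hb
    exact Finset.prod_eq_zero (Finset.mem_univ i) (by simpa using hi)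

/-- Second moment of an exponential sum with frequencies `a p` and phases `c p`. -/
theorem sum_sq_norm_sum_addChar {F ι : Type*} [Field F] [Fintype F] [DecidableEq F] {n : ℕ}
    {ψ : AddChar F ℂ} (hψ : ψ ≠ 1) (P : Finset ι) (a : ι → Fin n → F) (c : ι → F) :
    ∑ u : Fin n → F, ‖∑ p ∈ P, ψ (c p + dotp u (a p))‖ ^ 2 =
      (Fintype.card F : ℝ) ^ n *
        (∑ p ∈ P, ∑ r ∈ P, if a p = a r then ψ (c p - c r) else 0).re := by
  have key : ∑ u : Fin n → F, ((‖∑ p ∈ P, ψ (c p + dotp u (a p))‖ ^ 2 : ℝ) : ℂ) =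
      (Fintype.card F : ℂ) ^ n *
        ∑ p ∈ P, ∑ r ∈ P, if a p = a r then ψ (c p - c r) else 0 := by
    calc _ = ∑ u : Fin n → F, ∑ p ∈ P, ∑ r ∈ P, ψ (c p - c r) * ψ (dotp u (a p - a r)) := by
          refine Finset.sum_congr rfl fun u _ => ?_
          rw [Complex.ofReal_pow, ← Complex.mul_conj', map_sum, Finset.sum_mul_sum]
          refine Finset.sum_congr rfl fun p _ => Finset.sum_congr rfl fun r _ => ?_
          rw [← AddChar.map_neg_eq_conj, ← AddChar.map_add_eq_mul, ← AddChar.map_add_eq_mul,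
            dotp_sub]
          congr 1
          ring
      _ = ∑ p ∈ P, ∑ r ∈ P, ∑ u : Fin n → F, ψ (c p - c r) * ψ (dotp u (a p - a r)) := by
          rw [Finset.sum_comm]
          exact Finset.sum_congr rfl fun p _ => Finset.sum_comm
      _ = _ := by
          simp only [← Finset.mul_sum, sum_addChar_dotp hψ, sub_eq_zero]
          simp only [Finset.mul_sum]
          refine Finset.sum_congr rfl fun p _ => Finset.sum_congr rfl fun r _ => ?_
          split_ifs <;> ring
  have hre := congrArg Complex.re key
  rw [← Complex.ofReal_sum, Complex.ofReal_re] at hre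
  rw [hre, ← Complex.re_ofReal_mul]
  push_cast
  rfl

/-- For a nontrivial additive character `ψ` of a finite field `F` of odd
cardinality `q`, and `Z ⊆ F^n`, the sum `S_ψ(Z) = Σ_{u,v,w ∈ Z} ψ(Δ(u,v,w))`
satisfies `|S_ψ(Z)|² ≤ #Z · qⁿ · Re(Σ_{v+w=x+y} ψ(2(v·w − x·y)))`. -/
theorem sq_norm_S_le {F : Type*} [Field F] [Fintype F] [DecidableEq F]
    (hq : Odd (Fintype.card F)) {n : ℕ} (hn : 1 ≤ n)
    (ψ : AddChar F ℂ) (hψ : ψ ≠ 1) (Z : Finset (Fin n → F)) :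
    ‖∑ u ∈ Z, ∑ v ∈ Z, ∑ w ∈ Z, ψ (delta u v w)‖ ^ 2 ≤
      (Z.card : ℝ) * (Fintype.card F : ℝ) ^ n *
        (∑ v ∈ Z, ∑ w ∈ Z, ∑ x ∈ Z, ∑ y ∈ Z,
          if v + w = x + y then ψ (2 * (dotp v w - dotp x y)) else 0).re := by
  have h2 : (2 : F) ≠ 0 := two_ne_zero_of_odd_card hq
  let a : (Fin n → F) × (Fin n → F) → Fin n → F := fun p i => -2 * (p.1 + p.2) i
  let c : (Fin n → F) × (Fin n → F) → F := fun p => 2 * dotp p.1 p.2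
  have ha : ∀ p r, a p = a r ↔ p.1 + p.2 = r.1 + r.2 := fun p r => by
    simp only [a, funext_iff, mul_right_inj' (neg_ne_zero.mpr h2)]
  have hsum : (∑ v ∈ Z, ∑ w ∈ Z, ∑ x ∈ Z, ∑ y ∈ Z,
      if v + w = x + y then ψ (2 * (dotp v w - dotp x y)) else 0) =
      ∑ p ∈ Z ×ˢ Z, ∑ r ∈ Z ×ˢ Z, if a p = a r then ψ (c p - c r) else 0 := by
    simp only [Finset.sum_product, ha, c, mul_sub]
  have hnorm : ∀ u, ‖∑ v ∈ Z, ∑ w ∈ Z, ψ (delta u v w)‖ =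
      ‖∑ p ∈ Z ×ˢ Z, ψ (c p + dotp u (a p))‖ := fun u => by
    simp only [Finset.sum_product, delta_eq, AddChar.map_add_eq_mul ψ (2 * dotp u u),
      ← Finset.mul_sum, norm_mul, AddChar.norm_apply, one_mul, a, c]
  rw [hsum, mul_assoc, ← sum_sq_norm_sum_addChar hψ]
  calc _ ≤ (∑ u ∈ Z, ‖∑ v ∈ Z, ∑ w ∈ Z, ψ (delta u v w)‖) ^ 2 := by
        gcongr
        exact norm_sum_le _ _
    _ ≤ (Z.card : ℝ) * ∑ u ∈ Z, ‖∑ v ∈ Z, ∑ w ∈ Z, ψ (delta u v w)‖ ^ 2 :=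
        sq_sum_le_card_mul_sum_sq
    _ ≤ _ := by
        simp only [hnorm]
        gcongr
        exact Finset.subset_univ Z
end

section
/- Let q be an odd prime power, n ≥ 1, and ψ: F_q → ℂ a nontrivial additive character of F_q. For every finite set Z ⊆ F_q^n, the triple character sum S_ψ(Z) = Σ_{u,v,w ∈ Z} ψ(Δ(u,v,w)) satisfies |S_ψ(Z)| ≤ (#Z)^2 · q^{n/2}. -/
open Finset

lemma sum_addChar_dotProduct {F : Type*} [Field F] [Fintype F] {n : ℕ}
    {ψ : AddChar F ℂ} (hψ : ψ ≠ 1) {d : Fin n → F} (hd : d ≠ 0) :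
    ∑ x : Fin n → F, ψ (x ⬝ᵥ d) = 0 := by
  classical
  let φ : AddChar (Fin n → F) ℂ :=
    ψ.compAddMonoidHom (AddMonoidHom.mk' (fun x => x ⬝ᵥ d) fun x y => add_dotProduct x y d)
  refine AddChar.sum_eq_zero_of_ne_one (ψ := φ) fun h => hψ ?_
  obtain ⟨i, hi⟩ := Function.ne_iff.mp hd
  ext c
  have := DFunLike.congr_fun h (Pi.single i (c / d i))
  simpa [φ, div_mul_cancel₀ c hi] using this

lemma sum_norm_sq_sum_addChar_dotProduct {F : Type*} [Field F] [Fintype F] {n : ℕ}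
    {ψ : AddChar F ℂ} (hψ : ψ ≠ 1) (B : Finset (Fin n → F)) :
    ∑ x : Fin n → F, ‖∑ y ∈ B, ψ (x ⬝ᵥ y)‖ ^ 2 = B.card * (Fintype.card F : ℝ) ^ n := by
  classical
  have key : ∀ x : Fin n → F, ((‖∑ y ∈ B, ψ (x ⬝ᵥ y)‖ ^ 2 : ℝ) : ℂ) =
      ∑ y ∈ B, ∑ z ∈ B, ψ (x ⬝ᵥ (y - z)) := fun x => by
    rw [Complex.ofReal_pow, ← Complex.mul_conj', map_sum, Finset.sum_mul_sum]
    simp only [sub_eq_add_neg, dotProduct_add, dotProduct_neg,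
      AddChar.map_add_eq_mul, AddChar.map_neg_eq_conj]
  have orth : ∀ y z : Fin n → F, ∑ x : Fin n → F, ψ (x ⬝ᵥ (y - z)) =
      if y = z then (Fintype.card F : ℂ) ^ n else 0 := fun y z => by
    split_ifs with h
    · simp [h]
    · exact sum_addChar_dotProduct hψ (sub_ne_zero.mpr h)
  apply Complex.ofReal_injective
  rw [Complex.ofReal_sum, Finset.sum_congr rfl fun x _ => key x, Finset.sum_comm,
    Finset.sum_congr rfl fun y _ => Finset.sum_comm]
  simp only [orth]
  simp

lemma norm_sum_sum_addChar_dotProduct_le {F : Type*} [Field F] [Fintype F] {n : ℕ}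
    {ψ : AddChar F ℂ} (hψ : ψ ≠ 1) (A B : Finset (Fin n → F)) :
    ‖∑ x ∈ A, ∑ y ∈ B, ψ (x ⬝ᵥ y)‖ ^ 2 ≤ A.card * (B.card * (Fintype.card F : ℝ) ^ n) := by
  calc ‖∑ x ∈ A, ∑ y ∈ B, ψ (x ⬝ᵥ y)‖ ^ 2
      ≤ (∑ x ∈ A, ‖∑ y ∈ B, ψ (x ⬝ᵥ y)‖) ^ 2 := by gcongr; exact norm_sum_le _ _
    _ ≤ A.card * ∑ x ∈ A, ‖∑ y ∈ B, ψ (x ⬝ᵥ y)‖ ^ 2 := sq_sum_le_card_mul_sum_sq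
    _ ≤ A.card * ∑ x, ‖∑ y ∈ B, ψ (x ⬝ᵥ y)‖ ^ 2 := by
        gcongr
        exact Finset.subset_univ A
    _ = _ := by rw [sum_norm_sq_sum_addChar_dotProduct hψ]

lemma delta_eq_dotProduct {F : Type*} [Field F] {n : ℕ} (u v w : Fin n → F) :
    delta u v w = ((2 : F) • (u - v)) ⬝ᵥ (u - w) := by
  simp only [delta, dotProduct, Pi.smul_apply, Pi.sub_apply, smul_eq_mul]
  exact Finset.sum_congr rfl fun i _ => by ring

/-- For a nontrivial additive character `ψ` of a finite field `F` of odd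
cardinality `q`, and any finite `Z ⊆ F^n`, the triple character sum
`S_ψ(Z) = Σ_{u,v,w ∈ Z} ψ(Δ(u,v,w))` satisfies `|S_ψ(Z)| ≤ (#Z)² · q^{n/2}`. -/
theorem norm_S_le {F : Type*} [Field F] [Fintype F]
    (hq : Odd (Fintype.card F)) {n : ℕ} (hn : 1 ≤ n)
    (ψ : AddChar F ℂ) (hψ : ψ ≠ 1) (Z : Finset (Fin n → F)) :
    ‖∑ u ∈ Z, ∑ v ∈ Z, ∑ w ∈ Z, ψ (delta u v w)‖ ≤
      (Z.card : ℝ) ^ 2 * (Fintype.card F : ℝ) ^ ((n : ℝ) / 2) := by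
  classical
  have two_ne_zero' : (2 : F) ≠ 0 := Ring.two_ne_zero fun h =>
    (Nat.not_even_iff_odd.mpr hq) (Nat.even_iff.mpr (FiniteField.even_card_of_char_two h))
  have fiber (u : Fin n → F) : ‖∑ v ∈ Z, ∑ w ∈ Z, ψ (delta u v w)‖ ≤
      Z.card * (Fintype.card F : ℝ) ^ ((n : ℝ) / 2) := by
    have inj₁ : Function.Injective fun v : Fin n → F => (2 : F) • (u - v) :=
      (smul_right_injective _ two_ne_zero').comp sub_right_injective
    have inj₂ : Function.Injective fun w : Fin n → F => u - w := sub_right_injective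
    have h := norm_sum_sum_addChar_dotProduct_le hψ
      (Z.image fun v => (2 : F) • (u - v)) (Z.image fun w => u - w)
    rw [Finset.sum_image inj₁.injOn, Finset.card_image_of_injective _ inj₁,
      Finset.card_image_of_injective _ inj₂] at h
    simp only [Finset.sum_image inj₂.injOn, ← delta_eq_dotProduct] at h
    refine le_of_sq_le_sq (h.trans_eq ?_) (by positivity)
    rw [mul_pow, ← Real.rpow_mul_natCast (Nat.cast_nonneg _), Nat.cast_ofNat,
      div_mul_cancel₀ _ two_ne_zero, Real.rpow_natCast]
    ring
  calc ‖∑ u ∈ Z, ∑ v ∈ Z, ∑ w ∈ Z, ψ (delta u v w)‖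
      ≤ ∑ u ∈ Z, Z.card * (Fintype.card F : ℝ) ^ ((n : ℝ) / 2) :=
        norm_sum_le_of_le _ fun u _ => fiber u
    _ = _ := by rw [Finset.sum_const, nsmul_eq_mul]; ring
end

section
/- Let q be an odd prime power, Z ⊆ F_q^2 a finite set, and α ∈ F_q a non-square (quadratic non-residue), α ≠ 0. Let T denote the number of quadruples (u,v,w,z) with u,v,w ∈ Z and z ∈ F_q such that Δ(u,v,w) = α·z^2. Then |T − (#Z)^3| ≤ √2 · (#Z)^{3/2} · q^2. -/
open Finset

open Matrix in
/-- The autocorrelation `∑ χ(c·x) χ(c·(x+d))` of the quadratic character along linear forms. -/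
noncomputable def quadCorr {F : Type*} [Field F] [Fintype F] [DecidableEq F]
    (d : Fin 2 → F) : ℤ :=
  ∑ c : Fin 2 → F, ∑ x : Fin 2 → F,
    quadraticChar F (c ⬝ᵥ x) * quadraticChar F (c ⬝ᵥ (x + d))

section

open Matrix

variable {F : Type*} [Field F] [Fintype F] [DecidableEq F]

lemma delta_eq_two_mul_dotProduct {K : Type*} [Field K] {n : ℕ} (u v w : Fin n → K) :
    delta u v w = 2 * ((u - v) ⬝ᵥ (u - w)) := by
  simp only [delta, dotProduct, Finset.mul_sum, Pi.sub_apply]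
  exact Finset.sum_congr rfl fun i _ => by ring

lemma quadCorr_mulVec (M : Matrix (Fin 2) (Fin 2) F) (hM : IsUnit M) (d : Fin 2 → F) :
    quadCorr (M *ᵥ d) = quadCorr d := by
  have h1 : Function.Bijective M.mulVec :=
    Finite.injective_iff_bijective.1 (Matrix.mulVec_injective_iff_isUnit.2 hM)
  have h2 : Function.Bijective fun c : Fin 2 → F => c ᵥ* M :=
    Finite.injective_iff_bijective.1 (Matrix.vecMul_injective_iff_isUnit.2 hM)
  unfold quadCorr
  rw [← h2.sum_comp (fun c => ∑ x : Fin 2 → F,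
    quadraticChar F (c ⬝ᵥ x) * quadraticChar F (c ⬝ᵥ (x + d)))]
  refine Finset.sum_congr rfl fun c _ => ?_
  rw [← h1.sum_comp]
  refine Finset.sum_congr rfl fun x _ => ?_
  rw [← Matrix.mulVec_add, Matrix.dotProduct_mulVec, Matrix.dotProduct_mulVec]

lemma exists_isUnit_mulVec_eq {F : Type*} [Field F] (d : Fin 2 → F) (hd : d ≠ 0) :
    ∃ M : Matrix (Fin 2) (Fin 2) F, IsUnit M ∧ M *ᵥ ![1, 0] = d := by
  by_cases h0 : d 0 = 0
  · have h1 : d 1 ≠ 0 := fun h1 => hd (by ext i; fin_cases i <;> simp [h0, h1])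
    refine ⟨!![0, 1; d 1, 0], ?_, ?_⟩
    · simpa [Matrix.isUnit_iff_isUnit_det, Matrix.det_fin_two] using h1
    · ext i; fin_cases i <;> simp [h0, Matrix.mulVec, dotProduct]
  · refine ⟨!![d 0, 0; d 1, 1], ?_, ?_⟩
    · simpa [Matrix.isUnit_iff_isUnit_det, Matrix.det_fin_two] using h0
    · ext i; fin_cases i <;> simp [Matrix.mulVec, dotProduct]

lemma quadCorr_eq_of_ne_zero {d e : Fin 2 → F} (hd : d ≠ 0) (he : e ≠ 0) :
    quadCorr d = quadCorr e := by
  obtain ⟨M, hM, rfl⟩ := exists_isUnit_mulVec_eq d hd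
  obtain ⟨N, hN, rfl⟩ := exists_isUnit_mulVec_eq e he
  rw [quadCorr_mulVec M hM, quadCorr_mulVec N hN]

lemma sum_quadraticChar_dotProduct (hF : ringChar F ≠ 2) (c : Fin 2 → F) :
    ∑ x : Fin 2 → F, quadraticChar F (c ⬝ᵥ x) = 0 := by
  obtain ⟨a, ha⟩ := quadraticChar_exists_neg_one hF
  have ha0 : a ≠ 0 := by rintro rfl; simp at ha
  have hb : Function.Bijective fun x : Fin 2 → F => a • x :=
    Finite.injective_iff_bijective.1 (smul_right_injective _ ha0)
  have h := hb.sum_comp fun x => quadraticChar F (c ⬝ᵥ x)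
  simp only [dotProduct_smul, smul_eq_mul, map_mul, ha, neg_one_mul,
    Finset.sum_neg_distrib] at h
  omega

lemma sum_quadCorr (hF : ringChar F ≠ 2) : ∑ d : Fin 2 → F, quadCorr d = 0 := by
  unfold quadCorr
  rw [Finset.sum_comm]
  refine Finset.sum_eq_zero fun c _ => ?_
  rw [Finset.sum_comm]
  refine Finset.sum_eq_zero fun x _ => ?_
  have h := Function.Bijective.sum_comp (Equiv.addLeft x).bijective
    fun y => quadraticChar F (c ⬝ᵥ y)
  simp only [Equiv.coe_addLeft, sum_quadraticChar_dotProduct hF] at h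
  rw [← Finset.mul_sum, h, mul_zero]

lemma quadCorr_zero_nonneg : 0 ≤ quadCorr (0 : Fin 2 → F) := by
  unfold quadCorr
  refine Finset.sum_nonneg fun c _ => Finset.sum_nonneg fun x _ => ?_
  rw [add_zero]
  exact mul_self_nonneg _

lemma quadCorr_zero_le : quadCorr (0 : Fin 2 → F) ≤ (Fintype.card F : ℤ) ^ 4 := by
  have h (a : F) : quadraticChar F a * quadraticChar F a ≤ 1 := by
    by_cases ha : a = 0
    · simp [ha]
    · rw [← sq, quadraticChar_sq_one ha]
  calc quadCorr (0 : Fin 2 → F) ≤ ∑ _c : Fin 2 → F, ∑ _x : Fin 2 → F, (1 : ℤ) := by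
        unfold quadCorr
        refine Finset.sum_le_sum fun c _ => Finset.sum_le_sum fun x _ => ?_
        rw [add_zero]
        exact h _
    _ = (Fintype.card F : ℤ) ^ 4 := by
        simp
        ring

lemma quadCorr_nonpos (hF : ringChar F ≠ 2) {d : Fin 2 → F} (hd : d ≠ 0) :
    quadCorr d ≤ 0 := by
  have h := sum_quadCorr hF
  rw [← Finset.add_sum_erase _ _ (Finset.mem_univ 0),
    Finset.sum_congr rfl fun e he => quadCorr_eq_of_ne_zero (Finset.ne_of_mem_erase he) hd,
    Finset.sum_const, nsmul_eq_mul] at h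
  have hpos : (0 : ℤ) < ((Finset.univ.erase (0 : Fin 2 → F)).card : ℤ) := by
    exact_mod_cast Finset.card_pos.2 ⟨d, Finset.mem_erase.2 ⟨hd, Finset.mem_univ _⟩⟩
  have h0 := quadCorr_zero_nonneg (F := F)
  by_contra! hlt
  have := mul_pos hpos hlt
  omega

lemma sum_sum_mul_eq_quadCorr (w w' : Fin 2 → F) :
    ∑ u : Fin 2 → F, ∑ v : Fin 2 → F, quadraticChar F ((u - v) ⬝ᵥ (u - w)) *
      quadraticChar F ((u - v) ⬝ᵥ (u - w')) = quadCorr (w - w') := by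
  unfold quadCorr
  rw [Finset.sum_comm (f := fun c x => quadraticChar F (c ⬝ᵥ x) *
    quadraticChar F (c ⬝ᵥ (x + (w - w')))), eq_comm,
    ← Function.Bijective.sum_comp (Equiv.subRight w).bijective]
  refine Finset.sum_congr rfl fun u _ => ?_
  rw [← Function.Bijective.sum_comp (Equiv.subLeft u).bijective]
  refine Finset.sum_congr rfl fun v _ => ?_
  simp only [Equiv.subRight_apply, Equiv.subLeft_apply, sub_add_sub_cancel]

lemma sq_sum_quadraticChar_le (hF : ringChar F ≠ 2) (Z : Finset (Fin 2 → F)) :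
    (∑ u ∈ Z, ∑ v ∈ Z, ∑ w ∈ Z, quadraticChar F ((u - v) ⬝ᵥ (u - w))) ^ 2 ≤
      (Z.card : ℤ) ^ 3 * (Fintype.card F : ℤ) ^ 4 := by
  set f : (Fin 2 → F) × (Fin 2 → F) → ℤ := fun p =>
    ∑ w ∈ Z, quadraticChar F ((p.1 - p.2) ⬝ᵥ (p.1 - w)) with hf
  have hsum : ∑ p, f p ^ 2 ≤ (Z.card : ℤ) * (Fintype.card F : ℤ) ^ 4 := by
    calc ∑ p, f p ^ 2 = ∑ w ∈ Z, ∑ w' ∈ Z, quadCorr (w - w') := by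
          simp only [hf, sq, Finset.sum_mul_sum]
          rw [Finset.sum_comm]
          refine Finset.sum_congr rfl fun w _ => ?_
          rw [Finset.sum_comm]
          refine Finset.sum_congr rfl fun w' _ => ?_
          rw [Fintype.sum_prod_type, sum_sum_mul_eq_quadCorr]
      _ ≤ ∑ w ∈ Z, ∑ w' ∈ Z, if w = w' then (Fintype.card F : ℤ) ^ 4 else 0 := by
          refine Finset.sum_le_sum fun w _ => Finset.sum_le_sum fun w' _ => ?_
          split_ifs with h
          · rw [h, sub_self]
            exact quadCorr_zero_le
          · exact quadCorr_nonpos hF (sub_ne_zero.2 h)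
      _ = (Z.card : ℤ) * (Fintype.card F : ℤ) ^ 4 := by simp
  calc (∑ u ∈ Z, ∑ v ∈ Z, ∑ w ∈ Z, quadraticChar F ((u - v) ⬝ᵥ (u - w))) ^ 2
      = (∑ p ∈ Z ×ˢ Z, f p) ^ 2 := by rw [Finset.sum_product]
    _ ≤ ((Z ×ˢ Z).card : ℤ) * ∑ p ∈ Z ×ˢ Z, f p ^ 2 := sq_sum_le_card_mul_sum_sq
    _ ≤ ((Z ×ˢ Z).card : ℤ) * ∑ p, f p ^ 2 := by
        gcongr
        exact Finset.subset_univ _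
    _ ≤ ((Z ×ˢ Z).card : ℤ) * ((Z.card : ℤ) * (Fintype.card F : ℤ) ^ 4) := by gcongr
    _ = (Z.card : ℤ) ^ 3 * (Fintype.card F : ℤ) ^ 4 := by
        rw [Finset.card_product]
        push_cast
        ring

lemma card_eq_mul_sq_of_not_isSquare (hF : ringChar F ≠ 2) {α : F} (hα : ¬IsSquare α) (b : F) :
    ((Finset.univ.filter fun z : F => b = α * z ^ 2).card : ℤ) = 1 - quadraticChar F b := by
  have hα0 : α ≠ 0 := by rintro rfl; simp at hα
  have hχ : quadraticChar F α = -1 := quadraticChar_neg_one_iff_not_isSquare.2 hα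
  have hb : quadraticChar F b = -quadraticChar F (b / α) := by
    conv_lhs => rw [← mul_div_cancel₀ b hα0]
    rw [map_mul, hχ, neg_one_mul]
  rw [hb, sub_neg_eq_add, add_comm, ← quadraticChar_card_sqrts hF]
  congr 2
  ext z
  simp only [Finset.mem_filter, Finset.mem_univ, true_and, Set.mem_toFinset, Set.mem_ofPred_eq]
  rw [eq_div_iff hα0, mul_comm, eq_comm]

lemma card_delta_sub_cube (hF : ringChar F ≠ 2) (Z : Finset (Fin 2 → F)) {α : F}
    (hα : ¬IsSquare α) :
    ((((Z ×ˢ Z ×ˢ Z) ×ˢ (Finset.univ : Finset F)).filter fun p =>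
      delta p.1.1 p.1.2.1 p.1.2.2 = α * p.2 ^ 2).card : ℤ) - (Z.card : ℤ) ^ 3 =
      -(quadraticChar F 2 *
        ∑ u ∈ Z, ∑ v ∈ Z, ∑ w ∈ Z, quadraticChar F ((u - v) ⬝ᵥ (u - w))) := by
  have hcard : ((((Z ×ˢ Z ×ˢ Z) ×ˢ (Finset.univ : Finset F)).filter fun p =>
      delta p.1.1 p.1.2.1 p.1.2.2 = α * p.2 ^ 2).card : ℤ) =
      ∑ u ∈ Z, ∑ v ∈ Z, ∑ w ∈ Z, (1 - quadraticChar F (delta u v w)) := by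
    simp only [← card_eq_mul_sq_of_not_isSquare hF hα, Finset.card_filter, Finset.sum_product]
    push_cast
    rfl
  rw [hcard]
  simp only [delta_eq_two_mul_dotProduct, map_mul, Finset.sum_sub_distrib, Finset.sum_const,
    ← Finset.mul_sum, nsmul_eq_mul]
  ring

end

open Classical in
/-- For `Z ⊆ F_q²` and `α` a nonzero quadratic non-residue, the number `T` of
quadruples `(u,v,w,z)`, `u,v,w ∈ Z`, `z ∈ F_q`, with `Δ(u,v,w) = α z²`
satisfies `|T − (#Z)³| ≤ √2 · (#Z)^{3/2} · q²`. -/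
theorem count_near_cube {F : Type*} [Field F] [Fintype F]
    (hq : Odd (Fintype.card F)) (Z : Finset (Fin 2 → F)) (α : F)
    (hα0 : α ≠ 0) (hα : ¬∃ β : F, β ^ 2 = α) :
    |(((((Z ×ˢ Z ×ˢ Z) ×ˢ (Finset.univ : Finset F)).filter fun p =>
          delta p.1.1 p.1.2.1 p.1.2.2 = α * p.2 ^ 2).card : ℝ)) - (Z.card : ℝ) ^ 3| ≤
      Real.sqrt 2 * (Z.card : ℝ) ^ ((3 : ℝ) / 2) * (Fintype.card F : ℝ) ^ 2 := by
  have hF : ringChar F ≠ 2 := fun h =>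
    (Nat.not_even_iff_odd.2 hq) (Nat.even_iff.2 (FiniteField.even_card_of_char_two h))
  have hα' : ¬IsSquare α := fun ⟨β, hβ⟩ => hα ⟨β, by rw [hβ, sq]⟩
  have hT := card_delta_sub_cube hF Z hα'
  have hS := sq_sum_quadraticChar_le hF Z
  have h2 : quadraticChar F 2 ^ 2 = 1 := quadraticChar_sq_one (Ring.two_ne_zero hF)
  set T := (((Z ×ˢ Z ×ˢ Z) ×ˢ (Finset.univ : Finset F)).filter fun p =>
    delta p.1.1 p.1.2.1 p.1.2.2 = α * p.2 ^ 2).card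
  have hsq : ((T : ℤ) - (Z.card : ℤ) ^ 3) ^ 2 ≤ (Z.card : ℤ) ^ 3 * (Fintype.card F : ℤ) ^ 4 := by
    rw [hT, neg_sq, mul_pow, h2, one_mul]
    exact hS
  have hsqR : ((T : ℝ) - (Z.card : ℝ) ^ 3) ^ 2 ≤
      (Z.card : ℝ) ^ 3 * (Fintype.card F : ℝ) ^ 4 := by exact_mod_cast hsq
  have hpow : ((Z.card : ℝ) ^ ((3 : ℝ) / 2)) ^ 2 = (Z.card : ℝ) ^ 3 := by
    rw [← Real.rpow_natCast, ← Real.rpow_mul (Nat.cast_nonneg _)]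
    norm_num
  refine abs_le_of_sq_le_sq (hsqR.trans ?_) (by positivity)
  rw [mul_pow, mul_pow, Real.sq_sqrt (by norm_num), hpow, ← pow_mul]
  have : 0 ≤ (Z.card : ℝ) ^ 3 * (Fintype.card F : ℝ) ^ 4 := by positivity
  norm_num
  linarith
end
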